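/- arXiv:math/0607130 — 7 statements merged into one kernel-verified Lean document; each statement's English description precedes it below -/
import Mathlib

section
/- Let R be a commutative ring, let f, g ∈ R((t)), and let n, m be integers such that f_n is a unit of R, f_i is nilpotent for all i < n, g_m is a unit of R, and g_j is nilpotent for all j < m. Then the coefficient of the product f·g at n+m is a unit of R, and the coefficient of f·g at k is nilpotent for every k < n+m. (In particular, on units of R((t)) over a ring with connected spectrum, the order map ord satisfies ord(fg) = ord(f) + ord(g).) -/
/-- If the coefficients of `f` below `n` and those of `g` below `m` are nilpotent, the
coefficient of `f * g` at `k ≤ n + m` is, up to a nilpotent, the contribution of `(n, m)`. -/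
theorem LaurentSeries.isNilpotent_sum_erase {R : Type*} [CommRing R] {f g : LaurentSeries R}
    {n m k : ℤ} (hf : ∀ i < n, IsNilpotent (f.coeff i)) (hg : ∀ j < m, IsNilpotent (g.coeff j))
    (hk : k ≤ n + m) :
    IsNilpotent (∑ ij ∈ (Finset.antidiagonal f.isPWO_support g.isPWO_support k).erase (n, m),
      f.coeff ij.1 * g.coeff ij.2) := by
  refine isNilpotent_sum fun ⟨i, j⟩ hij => ?_
  obtain ⟨hne, hmem⟩ := Finset.mem_erase.mp hij
  have hsum : i + j = k := (Finset.mem_antidiagonal.mp hmem).2.2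
  rcases lt_or_ge i n with hi | hi
  · exact (Commute.all _ _).isNilpotent_mul_right (hf i hi)
  · have hj : j < m := by
      by_contra! hj
      exact hne (Prod.ext (by dsimp only; lia) (by dsimp only; lia))
    exact (Commute.all _ _).isNilpotent_mul_left (hg j hj)

/-- If `f_n` is a unit of `R` and `f_i` is nilpotent for all
`i < n`, and `g_m` is a unit of `R` and `g_j` is nilpotent for all `j < m`,
then the coefficient of `f·g` at `n + m` is a unit and the coefficient of
`f·g` at any `k < n + m` is nilpotent. -/
theorem stmt1 (R : Type*) [CommRing R] (f g : LaurentSeries R) (n m : ℤ)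
    (hfn : IsUnit (f.coeff n)) (hfnil : ∀ i : ℤ, i < n → IsNilpotent (f.coeff i))
    (hgm : IsUnit (g.coeff m)) (hgnil : ∀ j : ℤ, j < m → IsNilpotent (g.coeff j)) :
    IsUnit ((f * g).coeff (n + m)) ∧
      ∀ k : ℤ, k < n + m → IsNilpotent ((f * g).coeff k) := by
  constructor
  · have hnil := LaurentSeries.isNilpotent_sum_erase hfnil hgnil le_rfl
    have hcoeff : (f * g).coeff (n + m) = f.coeff n * g.coeff m +
        ∑ ij ∈ (Finset.antidiagonal f.isPWO_support g.isPWO_support (n + m)).erase (n, m),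
          f.coeff ij.1 * g.coeff ij.2 := by
      rw [HahnSeries.coeff_mul]
      by_cases h : (n, m) ∈ Finset.antidiagonal f.isPWO_support g.isPWO_support (n + m)
      · exact (Finset.add_sum_erase _ (fun ij => f.coeff ij.1 * g.coeff ij.2) h).symm
      · have hzero : f.coeff n * g.coeff m = 0 := by
          by_contra hne
          exact h (Finset.mem_antidiagonal.mpr
            ⟨left_ne_zero_of_mul hne, right_ne_zero_of_mul hne, rfl⟩)
        rw [Finset.erase_eq_of_notMem h, hzero, zero_add]
    rw [hcoeff]
    exact hnil.isUnit_add_left_of_commute (hfn.mul hgm) (Commute.all _ _)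
  · intro k hk
    have hnil := LaurentSeries.isNilpotent_sum_erase hfnil hgnil hk.le
    rwa [Finset.erase_eq_of_notMem fun h => hk.ne' (Finset.mem_antidiagonal.mp h).2.2,
      ← HahnSeries.coeff_mul] at hnil
end

section
/- Let R be a reduced commutative ring. If a is a unit of R((u)) satisfying the norm-one equation a·ā = 1, where ā denotes the Laurent series obtained from a by multiplying its n-th coefficient by (−1)^n for every n (i.e., ā = a(−u)), then all coefficients of a in negative degrees vanish and the constant coefficient of a is a unit of R; that is, a lies in R[[u]] and is a unit of the power series ring R[[u]]. -/
/-- The coefficientwise involution of `R((u))` induced by `u ↦ -u`: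
it sends `Σ aₙ uⁿ` to `Σ (-1)ⁿ aₙ uⁿ`. -/
def LaurentSeries.uBar {R : Type*} [CommRing R] (f : LaurentSeries R) :
    LaurentSeries R where
  coeff n := (((-1 : Rˣ) ^ n : Rˣ) : R) * f.coeff n
  isPWO_support' := f.isPWO_support'.mono (by
    intro n hn
    simp only [Function.mem_support] at hn ⊢
    intro h
    exact hn (by rw [h, mul_zero]))

namespace LaurentSeries

variable {R : Type*} [CommRing R]

theorem coeff_uBar (f : LaurentSeries R) (n : ℤ) :
    (uBar f).coeff n = (((-1 : Rˣ) ^ n : Rˣ) : R) * f.coeff n :=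
  rfl

theorem coeff_uBar_eq_zero_iff (f : LaurentSeries R) (n : ℤ) :
    (uBar f).coeff n = 0 ↔ f.coeff n = 0 := by
  rw [coeff_uBar, Units.mul_right_eq_zero]

theorem uBar_ne_zero {f : LaurentSeries R} (hf : f ≠ 0) : uBar f ≠ 0 := by
  intro h
  apply hf
  ext n
  rw [HahnSeries.coeff_zero, ← coeff_uBar_eq_zero_iff, h, HahnSeries.coeff_zero]

theorem order_uBar (f : LaurentSeries R) : (uBar f).order = f.order := by
  by_cases hf : f = 0
  · have : uBar f = f := by
      subst hf
      ext n
      simp [coeff_uBar]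
    rw [this]
  · apply le_antisymm
    · apply HahnSeries.order_le_of_coeff_ne_zero
      rw [Ne, coeff_uBar_eq_zero_iff]
      exact HahnSeries.coeff_order_eq_zero.not.mpr hf
    · apply HahnSeries.order_le_of_coeff_ne_zero
      rw [Ne, ← coeff_uBar_eq_zero_iff]
      exact HahnSeries.coeff_order_eq_zero.not.mpr (uBar_ne_zero hf)

theorem order_nonneg_of_mul_uBar_eq_one [IsReduced R] {f : LaurentSeries R}
    (h : f * uBar f = 1) : 0 ≤ f.order := by
  by_contra! hneg
  have hf : f ≠ 0 := by
    rintro rfl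
    simp at hneg
  apply HahnSeries.coeff_order_eq_zero.not.mpr hf
  have hlead := HahnSeries.coeff_mul_order_add_order f (uBar f)
  rw [h, HahnSeries.leadingCoeff_eq, HahnSeries.leadingCoeff_eq, order_uBar, coeff_uBar,
    HahnSeries.coeff_one, if_neg (by lia), mul_left_comm, eq_comm,
    Units.mul_right_eq_zero] at hlead
  exact sq_eq_zero_iff.mp ((sq _).trans hlead)

theorem exists_eq_ofPowerSeries {f : LaurentSeries R}
    (hf : ∀ n : ℤ, n < 0 → f.coeff n = 0) :
    ∃ p : PowerSeries R, f = HahnSeries.ofPowerSeries ℤ R p := by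
  refine ⟨PowerSeries.mk fun n => f.coeff n, ?_⟩
  ext n
  rw [PowerSeries.coeff_coe]
  split_ifs with hn
  · exact hf n hn
  · rw [PowerSeries.coeff_mk, Int.natAbs_of_nonneg (not_lt.mp hn)]

end LaurentSeries

/-- Let `R` be a reduced commutative ring.  If `a` is a unit
of `R((u))` with `a · ā = 1` (where `ā = a(-u)`), then `a` has vanishing
coefficients in all negative degrees, its constant coefficient is a unit of
`R`, and `a` is (the image of) a unit of the power series ring `R[[u]]`. -/
theorem stmt4 (R : Type*) [CommRing R] [IsReduced R]
    (a : (LaurentSeries R)ˣ)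
    (h : (a : LaurentSeries R) * LaurentSeries.uBar (a : LaurentSeries R) = 1) :
    (∀ n : ℤ, n < 0 → (a : LaurentSeries R).coeff n = 0) ∧
    IsUnit ((a : LaurentSeries R).coeff 0) ∧
    ∃ p : (PowerSeries R)ˣ,
      (a : LaurentSeries R) = HahnSeries.ofPowerSeries ℤ R (p : PowerSeries R) := by
  have hneg : ∀ n : ℤ, n < 0 → (a : LaurentSeries R).coeff n = 0 := fun n hn =>
    HahnSeries.coeff_eq_zero_of_lt_order
      (hn.trans_le (LaurentSeries.order_nonneg_of_mul_uBar_eq_one h))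
  obtain ⟨p, hp⟩ := LaurentSeries.exists_eq_ofPowerSeries hneg
  obtain ⟨q, hq⟩ := LaurentSeries.exists_eq_ofPowerSeries fun n hn =>
    (LaurentSeries.coeff_uBar_eq_zero_iff _ n).mpr (hneg n hn)
  have hpq : p * q = 1 := by
    apply HahnSeries.ofPowerSeries_injective (Γ := ℤ)
    rw [map_mul, map_one, ← hp, ← hq, h]
  have hunit : IsUnit p := IsUnit.of_mul_eq_one q hpq
  refine ⟨hneg, ?_, hunit.unit, hp⟩
  rw [hp, PowerSeries.coeff_coe, if_neg (lt_irrefl 0), Int.natAbs_zero,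
    PowerSeries.coeff_zero_eq_constantCoeff_apply]
  exact hunit.map PowerSeries.constantCoeff
end

section
/- Let R be a commutative ring and n ≥ 1 an integer that is invertible in R. Then every f ∈ R((t)) satisfying f^n = 1 is a constant series; that is, f is the image of an element c ∈ R with c^n = 1 under the canonical inclusion R → R((t)). In other words, μ_n(R((t))) = μ_n(R[[t]]) = μ_n(R). -/
/-- Every approximate `n`-th root of unity differs by a nilpotent from exactly one `n`-th root of
unity, when `n` is invertible. -/
theorem existsUnique_nilpotent_sub_and_pow_eq_one {S : Type*} [CommRing S] {n : ℕ} (hn : n ≠ 0)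
    (hinv : IsUnit (n : S)) {x : S} (hx : IsNilpotent (x ^ n - 1)) :
    ∃! r : S, IsNilpotent (x - r) ∧ r ^ n = 1 := by
  have hu : IsUnit x := by
    have h : IsUnit (x ^ n) := by simpa using hx.isUnit_add_one
    exact (isUnit_pow_iff hn).mp h
  have h := Polynomial.existsUnique_nilpotent_sub_and_aeval_eq_zero
    (P := (Polynomial.X ^ n - 1 : Polynomial S)) (x := x) (by simpa using hx)
    (by simpa [Polynomial.derivative_X_pow] using hinv.mul (hu.pow (n - 1)))
  simpa [sub_eq_zero] using h

/-- A power series with `f ^ n = 1` is constant when `n` is invertible. -/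
theorem PowerSeries.eq_C_of_pow_eq_one {R : Type*} [CommRing R] {n : ℕ} (hn : n ≠ 0)
    (hinv : IsUnit (n : R)) {f : PowerSeries R} (hf : f ^ n = 1) :
    f = PowerSeries.C (PowerSeries.constantCoeff f) := by
  have hc : PowerSeries.constantCoeff f ^ n = 1 := by rw [← map_pow, hf, map_one]
  have hu : IsUnit (∑ i ∈ Finset.range n,
      f ^ i * PowerSeries.C (PowerSeries.constantCoeff f) ^ (n - 1 - i)) := by
    rw [PowerSeries.isUnit_iff_constantCoeff]
    have h : ∀ i ∈ Finset.range n, PowerSeries.constantCoeff f ^ i *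
        PowerSeries.constantCoeff f ^ (n - 1 - i) = PowerSeries.constantCoeff f ^ (n - 1) := by
      intro i hi
      rw [← pow_add]
      congr 1
      have := Finset.mem_range.mp hi
      omega
    simp only [map_sum, map_mul, map_pow, PowerSeries.constantCoeff_C]
    rw [Finset.sum_congr rfl h, Finset.sum_const, Finset.card_range, nsmul_eq_mul]
    exact hinv.mul ((IsUnit.of_pow_eq_one hc hn).pow _)
  have h := geom_sum₂_mul f (PowerSeries.C (PowerSeries.constantCoeff f)) n
  rw [hf, ← map_pow, hc, map_one, sub_self] at h
  exact sub_eq_zero.mp (hu.mul_right_eq_zero.mp h)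

/-- The coefficients of negative index of a root of unity in `R((t))` are nilpotent. -/
theorem LaurentSeries.isNilpotent_coeff_of_pow_eq_one {R : Type*} [CommRing R] {n : ℕ}
    (hn : n ≠ 0) {f : LaurentSeries R} (hf : f ^ n = 1) {k : ℤ} (hk : k < 0) :
    IsNilpotent (f.coeff k) := by
  rw [nilpotent_iff_mem_prime]
  intro P hP
  have hmap : ∀ m : ℕ, (f ^ m).map (Ideal.Quotient.mk P) = f.map (Ideal.Quotient.mk P) ^ m := by
    intro m
    induction m with
    | zero =>
      rw [pow_zero, pow_zero]
      exact HahnSeries.map_one (Ideal.Quotient.mk P).toMonoidWithZeroHom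
    | succ m ih =>
      rw [pow_succ, pow_succ, ← ih]
      exact HahnSeries.map_mul (Ideal.Quotient.mk P : R →ₙ+* R ⧸ P)
  have h1 : f.map (Ideal.Quotient.mk P) ^ n = 1 := by
    rw [← hmap, hf]
    simpa using hmap 0
  have h2 := congrArg HahnSeries.order h1
  rw [HahnSeries.order_pow, HahnSeries.order_one, smul_eq_zero_iff_right hn] at h2
  have h3 := HahnSeries.coeff_eq_zero_of_lt_order (hk.trans_eq h2.symm)
  exact Ideal.Quotient.eq_zero_iff_mem.mp h3

/-- A Laurent series whose coefficients of negative index are nilpotent is the sum of a power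
series and a nilpotent Laurent series. -/
theorem LaurentSeries.exists_isNilpotent_sub_ofPowerSeries {R : Type*} [CommRing R]
    (f : LaurentSeries R) (hf : ∀ k < 0, IsNilpotent (f.coeff k)) :
    ∃ g : PowerSeries R, IsNilpotent (f - HahnSeries.ofPowerSeries ℤ R g) := by
  have key : ∀ (m : ℕ) (f : LaurentSeries R), (∀ k < 0, IsNilpotent (f.coeff k)) →
      (∀ k < -(m : ℤ), f.coeff k = 0) →
      ∃ g : PowerSeries R, IsNilpotent (f - HahnSeries.ofPowerSeries ℤ R g) := by
    intro m
    induction m with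
    | zero =>
      intro f _ h0
      refine ⟨PowerSeries.mk fun k => f.coeff k, ?_⟩
      suffices h : f = HahnSeries.ofPowerSeries ℤ R (PowerSeries.mk fun k => f.coeff k) by
        rw [← h, sub_self]
        exact IsNilpotent.zero
      ext k
      rw [PowerSeries.coeff_coe]
      split_ifs with hk
      · exact h0 k (by simpa using hk)
      · rw [PowerSeries.coeff_mk, Int.natAbs_of_nonneg (not_lt.mp hk)]
    | succ m ih =>
      intro f hf h0
      set a := f.coeff (-((m + 1 : ℕ) : ℤ)) with ha
      have hs : IsNilpotent (HahnSeries.single (-((m + 1 : ℕ) : ℤ)) a) := by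
        obtain ⟨l, hl⟩ := hf (-((m + 1 : ℕ) : ℤ)) (by omega)
        exact ⟨l, by rw [HahnSeries.single_pow, hl, map_zero]⟩
      have hcoeff : ∀ k, (f - HahnSeries.single (-((m + 1 : ℕ) : ℤ)) a).coeff k =
          if k = -((m + 1 : ℕ) : ℤ) then 0 else f.coeff k := by
        intro k
        rw [HahnSeries.coeff_sub, HahnSeries.coeff_single]
        split_ifs with hk
        · rw [hk, ← ha, sub_self]
        · rw [sub_zero]
      obtain ⟨g, hg⟩ := ih (f - HahnSeries.single (-((m + 1 : ℕ) : ℤ)) a)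
        (fun k hk => by
          rw [hcoeff]
          split_ifs
          exacts [IsNilpotent.zero, hf k hk])
        (fun k hk => by
          rw [hcoeff]
          split_ifs with h
          exacts [rfl, h0 k (by omega)])
      refine ⟨g, ?_⟩
      have h := (Commute.all _ _).isNilpotent_add hg hs
      rwa [sub_right_comm, sub_add_cancel] at h
  exact key f.order.natAbs f hf fun k hk => HahnSeries.coeff_eq_zero_of_lt_order (by omega)


/-- Let `R` be a commutative ring and `n ≥ 1` an integer
invertible in `R`.  Every `f ∈ R((t))` with `fⁿ = 1` is a constant series:
`f` is the image under the canonical inclusion `R → R((t))` of an element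
`c ∈ R` with `cⁿ = 1`.  (So `μ_n(R((t))) = μ_n(R[[t]]) = μ_n(R)`.) -/
theorem stmt9 (R : Type*) [CommRing R] (n : ℕ) (hn : 1 ≤ n)
    (hinv : IsUnit (n : R)) (f : LaurentSeries R) (hf : f ^ n = 1) :
    ∃ c : R, c ^ n = 1 ∧ f = HahnSeries.C c := by
  have hn0 : n ≠ 0 := by omega
  obtain ⟨g, hg⟩ := LaurentSeries.exists_isNilpotent_sub_ofPowerSeries f
    fun k hk => LaurentSeries.isNilpotent_coeff_of_pow_eq_one hn0 hf hk
  have hgn : IsNilpotent (g ^ n - 1) := by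
    rw [← IsNilpotent.map_iff (f := HahnSeries.ofPowerSeries ℤ R)
      HahnSeries.ofPowerSeries_injective, map_sub, map_pow, map_one, ← hf, ← neg_sub,
      isNilpotent_neg_iff]
    obtain ⟨d, hd⟩ := sub_dvd_pow_sub_pow f (HahnSeries.ofPowerSeries ℤ R g) n
    rw [hd]
    exact (Commute.all _ _).isNilpotent_mul_right hg
  have hinvP : IsUnit (n : PowerSeries R) := by
    simpa using hinv.map (PowerSeries.C (R := R))
  have hinvL : IsUnit (n : LaurentSeries R) := by
    simpa using hinvP.map (HahnSeries.ofPowerSeries ℤ R)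
  obtain ⟨q, ⟨hgq, hq⟩, -⟩ := existsUnique_nilpotent_sub_and_pow_eq_one hn0 hinvP hgn
  have hfq : f = HahnSeries.ofPowerSeries ℤ R q := by
    refine (existsUnique_nilpotent_sub_and_pow_eq_one hn0 hinvL (x := f)
      (by rw [hf, sub_self]; exact IsNilpotent.zero)).unique
      ⟨by rw [sub_self]; exact IsNilpotent.zero, hf⟩ ⟨?_, by rw [← map_pow, hq, map_one]⟩
    have h := (Commute.all _ _).isNilpotent_add hg (hgq.map (HahnSeries.ofPowerSeries ℤ R))
    rwa [map_sub, sub_add_sub_cancel] at h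
  refine ⟨PowerSeries.constantCoeff q, by rw [← map_pow, hq, map_one], ?_⟩
  rw [hfq, ← HahnSeries.ofPowerSeries_C, ← PowerSeries.eq_C_of_pow_eq_one hn0 hinv hq]
end

section
/- Let p be a prime and let R be a commutative ring of characteristic p. Then every f ∈ R((t)) satisfying f^p = 1 can be written uniquely as f = q·h, where q ∈ R((t)) has coefficient 1 at degree 0, vanishing coefficients in all positive degrees, and all coefficients x in negative degrees satisfy x^p = 0 (so q = 1 + x_1 t^{-1} + ⋯ + x_N t^{-N} with x_i^p = 0), and where h ∈ R[[t]] is a power series with h^p = 1. (This is the description of the affine Grassmannian of μ_p as the infinite product of the schemes Spec k[x_i]/(x_i^p).) -/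
namespace LaurentSeries

open HahnSeries

section Coefficients

variable {R : Type*} [CommRing R]

lemma coeff_mul_mem {I J : Ideal R} {x y : LaurentSeries R} (hx : ∀ i, x.coeff i ∈ I)
    (hy : ∀ i, y.coeff i ∈ J) (k : ℤ) : (x * y).coeff k ∈ I * J := by
  rw [HahnSeries.coeff_mul]
  exact Ideal.sum_mem _ fun ij _ => Ideal.mul_mem_mul (hx _) (hy _)

lemma coeff_mul_eq_zero_of_forall {x y : LaurentSeries R} {k : ℤ}
    (h : ∀ i j, i + j = k → x.coeff i = 0 ∨ y.coeff j = 0) : (x * y).coeff k = 0 := by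
  rw [HahnSeries.coeff_mul]
  refine Finset.sum_eq_zero fun ij hij => ?_
  rw [Finset.mem_antidiagonal] at hij
  rcases h _ _ hij.2.2 with h | h <;> simp [h]

lemma coeff_mul_eq_zero_of_lt {x y : LaurentSeries R} {a b : ℤ}
    (hx : ∀ i, i < a → x.coeff i = 0) (hy : ∀ i, i < b → y.coeff i = 0) :
    ∀ k, k < a + b → (x * y).coeff k = 0 := by
  refine fun k hk => coeff_mul_eq_zero_of_forall fun i j hij => ?_
  rcases lt_or_ge i a with h | h
  · exact .inl (hx i h)
  · exact .inr (hy j (by omega))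

lemma coeff_mul_eq_zero_of_gt {x y : LaurentSeries R} {a b : ℤ}
    (hx : ∀ i, a < i → x.coeff i = 0) (hy : ∀ i, b < i → y.coeff i = 0) :
    ∀ k, a + b < k → (x * y).coeff k = 0 := by
  refine fun k hk => coeff_mul_eq_zero_of_forall fun i j hij => ?_
  rcases lt_or_ge a i with h | h
  · exact .inl (hx i h)
  · exact .inr (hy j (by omega))

lemma coeff_mul_add_of_gt {x y : LaurentSeries R} {a b : ℤ}
    (hx : ∀ i, a < i → x.coeff i = 0) (hy : ∀ i, b < i → y.coeff i = 0) :
    (x * y).coeff (a + b) = x.coeff a * y.coeff b := by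
  rw [HahnSeries.coeff_mul]
  refine Finset.sum_eq_single (a, b) (fun ij hij hne => ?_) (fun h => ?_)
  · rw [Finset.mem_antidiagonal] at hij
    obtain ⟨h1, h2, h3⟩ := hij
    exfalso
    have h4 : ij.1 ≤ a := not_lt.1 fun h => h1 (hx _ h)
    have h5 : ij.2 ≤ b := not_lt.1 fun h => h2 (hy _ h)
    exact hne (Prod.ext (by dsimp only; omega) (by dsimp only; omega))
  · rw [Finset.mem_antidiagonal] at h
    simp only [HahnSeries.mem_support, and_true, not_and_or, not_not] at h
    rcases h with h | h <;> simp [h]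

lemma coeff_pow_eq_zero_of_lt {x : LaurentSeries R} {a : ℤ}
    (hx : ∀ i, i < a → x.coeff i = 0) (n : ℕ) :
    ∀ k, k < n * a → (x ^ n).coeff k = 0 := by
  induction n with
  | zero =>
    intro k hk
    rw [pow_zero, HahnSeries.coeff_one, if_neg (by push_cast at hk; omega)]
  | succ n ih =>
    intro k hk
    rw [pow_succ]
    exact coeff_mul_eq_zero_of_lt ih hx k (by push_cast at hk; linarith)

lemma coeff_pow_of_gt {x : LaurentSeries R} {a : ℤ}
    (hx : ∀ i, a < i → x.coeff i = 0) (n : ℕ) :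
    (∀ k, n * a < k → (x ^ n).coeff k = 0) ∧ (x ^ n).coeff (n * a) = x.coeff a ^ n := by
  induction n with
  | zero =>
    refine ⟨fun k hk => ?_, by simp⟩
    rw [pow_zero, HahnSeries.coeff_one, if_neg (by push_cast at hk; omega)]
  | succ n ih =>
    have h : ((n + 1 : ℕ) : ℤ) * a = n * a + a := by push_cast; ring
    rw [h, pow_succ, pow_succ, coeff_mul_add_of_gt ih.1 hx, ih.2]
    exact ⟨coeff_mul_eq_zero_of_gt ih.1 hx, rfl⟩

lemma coeff_pow_char (p : ℕ) (hp : p.Prime) [CharP R p] (x : LaurentSeries R) (n : ℤ) :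
    (x ^ p).coeff (p * n) = x.coeff n ^ p := by
  have : Fact p.Prime := ⟨hp⟩
  have : CharP (LaurentSeries R) p :=
    charP_of_injective_ringHom (f := (HahnSeries.C : R →+* LaurentSeries R))
      HahnSeries.C_injective p
  have hlow : ∀ i, n < i → (truncLT (n + 1) x).coeff i = 0 := fun i hi => by
    rw [HahnSeries.coeff_truncLT, if_neg (by omega)]
  have hhigh : ∀ i, i < n + 1 → (x - truncLT (n + 1) x).coeff i = 0 := fun i hi => by
    rw [HahnSeries.coeff_sub, HahnSeries.coeff_truncLT, if_pos hi, sub_self]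
  have hp0 : (0 : ℤ) < p := by exact_mod_cast hp.pos
  rw [← add_sub_cancel (truncLT (n + 1) x) x, add_pow_char, HahnSeries.coeff_add,
    (coeff_pow_of_gt hlow p).2, coeff_pow_eq_zero_of_lt hhigh p _ (by nlinarith),
    add_zero, HahnSeries.coeff_add, hhigh n (by omega), add_zero]

lemma coeff_ofPowerSeries_of_neg (g : PowerSeries R) {i : ℤ} (hi : i < 0) :
    (ofPowerSeries ℤ R g).coeff i = 0 := by
  rw [PowerSeries.coeff_coe, if_pos hi]

lemma eq_one_of_eq_ofPowerSeries {x : LaurentSeries R} {g : PowerSeries R}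
    (hx : ∀ i, 0 < i → x.coeff i = 0) (hx0 : x.coeff 0 = 1) (hg : x = ofPowerSeries ℤ R g) :
    x = 1 := by
  ext i
  rw [HahnSeries.coeff_one]
  rcases lt_trichotomy i 0 with hi | rfl | hi
  · rw [hg, coeff_ofPowerSeries_of_neg g hi, if_neg hi.ne]
  · rw [hx0, if_pos rfl]
  · rw [hx i hi, if_neg hi.ne']

end Coefficients

section Toeplitz

variable {R : Type*} [CommRing R]

/-- The part of a Laurent series in nonnegative degrees. -/
noncomputable def nonnegPart : LaurentSeries R →ₗ[R] PowerSeries R where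
  toFun x := PowerSeries.mk fun n => x.coeff n
  map_add' x y := by ext; simp
  map_smul' r x := by ext; simp

@[simp]
lemma coeff_nonnegPart (x : LaurentSeries R) (n : ℕ) :
    PowerSeries.coeff n (nonnegPart x) = x.coeff n := by
  simp [nonnegPart]

@[simp]
lemma nonnegPart_ofPowerSeries (g : PowerSeries R) : nonnegPart (ofPowerSeries ℤ R g) = g := by
  ext n
  simp

/-- The Toeplitz operator with symbol `x`: multiplication by `x`, followed by truncation to
nonnegative degrees. -/
noncomputable def toeplitz (x : LaurentSeries R) : PowerSeries R →ₗ[R] PowerSeries R where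
  toFun g := nonnegPart (x * ofPowerSeries ℤ R g)
  map_add' g h := by rw [map_add, mul_add, map_add]
  map_smul' r g := by
    rw [PowerSeries.coe_smul, ← HahnSeries.single_zero_mul_eq_smul, mul_left_comm,
      HahnSeries.single_zero_mul_eq_smul, map_smul, RingHom.id_apply]

lemma toeplitz_apply (x : LaurentSeries R) (g : PowerSeries R) :
    toeplitz x g = nonnegPart (x * ofPowerSeries ℤ R g) := rfl

lemma coeff_toeplitz_mem {I J : Ideal R} {x : LaurentSeries R} (hx : ∀ i, x.coeff i ∈ I)
    {g : PowerSeries R} (hg : ∀ n, PowerSeries.coeff n g ∈ J) (n : ℕ) :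
    PowerSeries.coeff n (toeplitz x g) ∈ I * J := by
  rw [toeplitz_apply, coeff_nonnegPart]
  refine coeff_mul_mem hx (fun i => ?_) n
  rw [PowerSeries.coeff_coe]
  split_ifs
  exacts [J.zero_mem, hg _]

lemma isNilpotent_mulLeft_mul_toeplitz {I : Ideal R} (hI : IsNilpotent I) {x : LaurentSeries R}
    (hx : ∀ i, x.coeff i ∈ I) (v : PowerSeries R) :
    IsNilpotent (LinearMap.mulLeft R v * toeplitz x : Module.End R (PowerSeries R)) := by
  obtain ⟨k, hk⟩ := hI
  have key (m : ℕ) (g : PowerSeries R) (n : ℕ) : PowerSeries.coeff n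
      (((LinearMap.mulLeft R v * toeplitz x : Module.End R (PowerSeries R)) ^ m) g) ∈ I ^ m := by
    induction m generalizing n with
    | zero => simp
    | succ m ih =>
      rw [pow_succ' (LinearMap.mulLeft R v * toeplitz x), Module.End.mul_apply, Module.End.mul_apply, LinearMap.mulLeft_apply,
        PowerSeries.coeff_mul, pow_succ' I]
      exact Ideal.sum_mem _ fun ij _ => Ideal.mul_mem_left _ _ (coeff_toeplitz_mem hx ih _)
  refine ⟨k, LinearMap.ext fun g => PowerSeries.ext fun n => ?_⟩
  simpa [hk] using key k g n

/-- A Laurent series whose coefficient in degree `0` is a unit, and whose coefficients in negative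
degrees are nilpotent, can be multiplied by a power series into `1 + t⁻¹R[t⁻¹]`. -/
lemma exists_nonnegPart_mul_eq_one {f : LaurentSeries R} (h0 : IsUnit (f.coeff 0))
    (hneg : ∀ i, i < 0 → IsNilpotent (f.coeff i)) :
    ∃ g : PowerSeries R, nonnegPart (f * ofPowerSeries ℤ R g) = 1 := by
  set u : PowerSeries R := nonnegPart f
  set x : LaurentSeries R := f - ofPowerSeries ℤ R u
  have hu : IsUnit u := by
    rw [PowerSeries.isUnit_iff_constantCoeff, ← PowerSeries.coeff_zero_eq_constantCoeff_apply,
      coeff_nonnegPart]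
    exact h0
  obtain ⟨v, huv⟩ := hu.exists_right_inv
  have hxneg (i : ℤ) (hi : i < 0) : x.coeff i = f.coeff i := by
    rw [HahnSeries.coeff_sub, coeff_ofPowerSeries_of_neg u hi, sub_zero]
  have hxnonneg (i : ℤ) (hi : 0 ≤ i) : x.coeff i = 0 := by
    lift i to ℕ using hi
    simp [x, u]
  set I : Ideal R := Ideal.span (x.coeff '' Set.Ico f.order 0)
  have hIfg : I.FG := Submodule.fg_span ((Set.finite_Ico _ _).image _)
  have hI : IsNilpotent I := by
    rw [hIfg.isNilpotent_iff_le_nilradical, Ideal.span_le]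
    rintro _ ⟨i, hi, rfl⟩
    rw [hxneg i hi.2]
    exact hneg i hi.2
  have hxI (i : ℤ) : x.coeff i ∈ I := by
    rcases lt_or_ge i 0 with hi | hi
    · rcases lt_or_ge i f.order with h | h
      · rw [hxneg i hi, HahnSeries.coeff_eq_zero_of_lt_order h]
        exact I.zero_mem
      · exact Ideal.subset_span ⟨i, ⟨h, hi⟩, rfl⟩
    · rw [hxnonneg i hi]
      exact I.zero_mem
  have hunit := (isNilpotent_mulLeft_mul_toeplitz hI hxI v).isUnit_one_add
  obtain ⟨g, hg⟩ := ((Module.End.isUnit_iff _).1 hunit).2 v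
  refine ⟨g, ?_⟩
  have hf : f = ofPowerSeries ℤ R u + x := by simp [x]
  rw [LinearMap.add_apply, Module.End.one_apply, Module.End.mul_apply,
    LinearMap.mulLeft_apply, toeplitz_apply] at hg
  rw [hf, add_mul, map_add, ← map_mul, nonnegPart_ofPowerSeries]
  calc u * g + nonnegPart (x * ofPowerSeries ℤ R g)
      = u * g + u * v * nonnegPart (x * ofPowerSeries ℤ R g) := by rw [huv, one_mul]
    _ = u * (g + v * nonnegPart (x * ofPowerSeries ℤ R g)) := by ring
    _ = 1 := by rw [hg, huv]

end Toeplitz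

section CharP

variable {R : Type*} [CommRing R]

lemma exists_eq_mul_ofPowerSeries (p : ℕ) (hp : p.Prime) [CharP R p] {f : LaurentSeries R}
    (hf : f ^ p = 1) :
    ∃ (q : LaurentSeries R) (h : PowerSeries R), q.coeff 0 = 1 ∧ (∀ i, 0 < i → q.coeff i = 0) ∧
      (∀ i, i < 0 → q.coeff i ^ p = 0) ∧ h ^ p = 1 ∧ f = q * ofPowerSeries ℤ R h := by
  have hp0 : (p : ℤ) ≠ 0 := by exact_mod_cast hp.ne_zero
  have hcoeff (i : ℤ) : f.coeff i ^ p = if i = 0 then 1 else 0 := by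
    rw [← coeff_pow_char p hp, hf, HahnSeries.coeff_one]
    simp [hp.ne_zero]
  obtain ⟨g, hg⟩ := exists_nonnegPart_mul_eq_one (f := f)
    (IsUnit.of_pow_eq_one (by rw [hcoeff, if_pos rfl]) hp.ne_zero)
    (fun i hi => ⟨p, by rw [hcoeff, if_neg hi.ne]⟩)
  set q := f * ofPowerSeries ℤ R g with hq
  have hqcoeff (n : ℕ) : q.coeff n = if n = 0 then 1 else 0 := by
    rw [← coeff_nonnegPart, hg, PowerSeries.coeff_one]
  have hq0 : q.coeff 0 = 1 := by simpa using hqcoeff 0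
  have hqpos (i : ℤ) (hi : 0 < i) : q.coeff i = 0 := by
    lift i to ℕ using hi.le
    rw [hqcoeff, if_neg (by omega)]
  have hqg : q ^ p = ofPowerSeries ℤ R (g ^ p) := by rw [hq, mul_pow, hf, one_mul, map_pow]
  have hqp := coeff_pow_of_gt hqpos p
  rw [mul_zero, hq0, one_pow] at hqp
  have hq1 : q ^ p = 1 := eq_one_of_eq_ofPowerSeries hqp.1 hqp.2 hqg
  have hg1 : g ^ p = 1 := by
    apply HahnSeries.ofPowerSeries_injective (Γ := ℤ)
    rw [← hqg, hq1, map_one]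
  have hgg : g * g ^ (p - 1) = 1 := by rw [← pow_succ', Nat.sub_add_cancel hp.one_le, hg1]
  refine ⟨q, g ^ (p - 1), hq0, hqpos, fun i hi => ?_, ?_, ?_⟩
  · rw [← coeff_pow_char p hp, hq1, HahnSeries.coeff_one, if_neg (mul_ne_zero hp0 hi.ne)]
  · rw [← pow_mul, mul_comm, pow_mul, hg1, one_pow]
  · rw [hq, mul_assoc, ← map_mul, hgg, map_one, mul_one]

lemma eq_of_mul_ofPowerSeries_eq {p : ℕ} (hp : p ≠ 0) {q q' : LaurentSeries R}
    {h h' : PowerSeries R} (hq0 : q.coeff 0 = 1) (hq : ∀ i, 0 < i → q.coeff i = 0)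
    (hq0' : q'.coeff 0 = 1) (hq' : ∀ i, 0 < i → q'.coeff i = 0)
    (hh : h ^ p = 1) (hh' : h' ^ p = 1)
    (hf : (q' * ofPowerSeries ℤ R h') ^ p = 1)
    (heq : q * ofPowerSeries ℤ R h = q' * ofPowerSeries ℤ R h') : q = q' ∧ h = h' := by
  have hqp' : q' ^ p = 1 := by
    rwa [mul_pow, ← map_pow, hh', map_one, mul_one] at hf
  have hqq : q' ^ (p - 1) * q' = 1 := by
    rw [← pow_succ, Nat.sub_add_cancel (Nat.one_le_iff_ne_zero.2 hp), hqp']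
  have hhh : h * h ^ (p - 1) = 1 := by
    rw [← pow_succ', Nat.sub_add_cancel (Nat.one_le_iff_ne_zero.2 hp), hh]
  have hr := coeff_pow_of_gt hq' (p - 1)
  rw [mul_zero, hq0', one_pow] at hr
  have h1 : q' ^ (p - 1) * q = 1 := by
    refine eq_one_of_eq_ofPowerSeries (g := h' * h ^ (p - 1))
      (coeff_mul_eq_zero_of_gt hr.1 hq) ?_ ?_
    · have := coeff_mul_add_of_gt hr.1 hq
      rwa [hr.2, hq0, add_zero, one_mul] at this
    · calc q' ^ (p - 1) * q
          = q' ^ (p - 1) * (q * ofPowerSeries ℤ R (h * h ^ (p - 1))) := by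
            rw [hhh, map_one, mul_one]
        _ = q' ^ (p - 1) * (q * ofPowerSeries ℤ R h) * ofPowerSeries ℤ R (h ^ (p - 1)) := by
            rw [map_mul]; ring
        _ = q' ^ (p - 1) * q' * ofPowerSeries ℤ R (h' * h ^ (p - 1)) := by
            rw [heq, map_mul]; ring
        _ = ofPowerSeries ℤ R (h' * h ^ (p - 1)) := by rw [hqq, one_mul]
  have hqeq : q = q' := by
    calc q = q' ^ (p - 1) * q' * q := by rw [hqq, one_mul]
      _ = q' ^ (p - 1) * q * q' := by ring
      _ = q' := by rw [h1, one_mul]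
  refine ⟨hqeq, HahnSeries.ofPowerSeries_injective (Γ := ℤ) ?_⟩
  have hunit : IsUnit q' := .of_mul_eq_one_right _ hqq
  rw [hqeq] at heq
  exact hunit.mul_left_cancel heq

end CharP

end LaurentSeries

/-- Let `p` be a prime and `R` a commutative ring of
characteristic `p`.  Every `f ∈ R((t))` with `f^p = 1` can be written uniquely
as `f = q · h`, where `q ∈ R((t))` has coefficient `1` at degree `0`,
vanishing coefficients in positive degrees, and coefficients `x` with
`x^p = 0` in negative degrees, and where `h ∈ R[[t]]` satisfies `h^p = 1`.
(This describes the affine Grassmannian of `μ_p`.) -/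
theorem stmt11 (p : ℕ) (hp : p.Prime) (R : Type*) [CommRing R] [CharP R p]
    (f : LaurentSeries R) (hf : f ^ p = 1) :
    ∃! qh : LaurentSeries R × PowerSeries R,
      qh.1.coeff 0 = 1 ∧
      (∀ i : ℤ, 0 < i → qh.1.coeff i = 0) ∧
      (∀ i : ℤ, i < 0 → qh.1.coeff i ^ p = 0) ∧
      qh.2 ^ p = 1 ∧
      f = qh.1 * HahnSeries.ofPowerSeries ℤ R qh.2 := by
  obtain ⟨q, h, hq0, hqpos, hqneg, hh, hqh⟩ := LaurentSeries.exists_eq_mul_ofPowerSeries p hp hf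
  refine ⟨(q, h), ⟨hq0, hqpos, hqneg, hh, hqh⟩, ?_⟩
  rintro ⟨q', h'⟩ ⟨hq0', hqpos', -, hh', hqh'⟩
  obtain ⟨rfl, rfl⟩ := LaurentSeries.eq_of_mul_ofPowerSeries_eq hp.ne_zero hq0' hqpos' hq0 hqpos
    hh' hh (hqh ▸ hf) (hqh'.symm.trans hqh)
  rfl
end

section
/- Let k be a field of characteristic 2 and let R = k[x]/(x²), with ε ∈ R the class of x (so ε ≠ 0 and ε² = 0). Then the unit 1 + ε·t^{-1} of R((t)) cannot be written in the form f²·g with f a unit of R((t)) and g a unit of the power series ring R[[t]]. (This witnesses that the affine flag variety of PGL₂ in characteristic 2 is not reduced.) -/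
/-- In characteristic `2`, the square of a Laurent series over the dual numbers has all its
coefficients in the base ring. -/
theorem LaurentSeries.snd_coeff_sq_eq_zero {k : Type*} [CommRing k] [CharP k 2]
    (f : LaurentSeries (DualNumber k)) (n : ℤ) : ((f ^ 2).coeff n).snd = 0 := by
  rw [sq, HahnSeries.coeff_mul, TrivSqZeroExt.snd_sum]
  refine Finset.sum_involution (fun p _ => p.swap) ?_ ?_ ?_ ?_
  · intro p _
    simp only [Prod.fst_swap, Prod.snd_swap, mul_comm (f.coeff p.2)]
    exact CharTwo.add_self_eq_zero _
  · intro p _ hp h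
    have h12 : p.2 = p.1 := congrArg Prod.fst h
    apply hp
    rw [h12, DualNumber.snd_mul, mul_comm]
    exact CharTwo.add_self_eq_zero _
  · intro p hp
    simp only [Finset.mem_antidiagonal, Prod.fst_swap, Prod.snd_swap] at hp ⊢
    exact ⟨hp.2.1, hp.1, by rw [add_comm]; exact hp.2.2⟩
  · intro p _
    exact Prod.swap_swap p

/-- Let `k` be a field of characteristic `2` and
`R = k[x]/(x²)` (the dual numbers over `k`), with `ε` the class of `x`.
The unit `1 + ε·t⁻¹` of `R((t))` cannot be written as `f² · g` with `f` a unit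
of `R((t))` and `g` a unit of the power series ring `R[[t]]`.  (This witnesses
the non-reducedness of the affine flag variety of `PGL₂` in characteristic 2.) -/
theorem stmt12 (k : Type*) [Field k] [CharP k 2] :
    ¬ ∃ (f : (LaurentSeries (DualNumber k))ˣ) (g : (PowerSeries (DualNumber k))ˣ),
      (1 + HahnSeries.single (-1 : ℤ) (DualNumber.eps : DualNumber k)
          : LaurentSeries (DualNumber k)) =
        ((f : LaurentSeries (DualNumber k)) ^ 2) *
          HahnSeries.ofPowerSeries ℤ (DualNumber k) (g : PowerSeries (DualNumber k)) := by
  rintro ⟨f, g, h⟩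
  set u : PowerSeries (DualNumber k) := ↑g⁻¹ with hu
  have hf : (f : LaurentSeries (DualNumber k)) ^ 2 =
      (1 + HahnSeries.single (-1 : ℤ) (DualNumber.eps : DualNumber k)) *
        HahnSeries.ofPowerSeries ℤ (DualNumber k) u := by
    rw [h, mul_assoc, ← map_mul, hu, Units.mul_inv, map_one, mul_one]
  have hneg : (HahnSeries.ofPowerSeries ℤ (DualNumber k) u).coeff (-1) = 0 := by
    rw [HahnSeries.ofPowerSeries_apply]
    refine HahnSeries.embDomain_of_notMem_range ?_
    rintro ⟨m, hm⟩
    have hm' : (m : ℤ) = -1 := hm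
    omega
  have hzero : (HahnSeries.ofPowerSeries ℤ (DualNumber k) u).coeff 0 =
      PowerSeries.constantCoeff u := by
    simpa using HahnSeries.ofPowerSeries_apply_coeff (Γ := ℤ) u 0
  have hsnd := LaurentSeries.snd_coeff_sq_eq_zero (f : LaurentSeries (DualNumber k)) (-1)
  have hcoeff := HahnSeries.coeff_single_mul_add (r := (DualNumber.eps : DualNumber k))
    (x := HahnSeries.ofPowerSeries ℤ (DualNumber k) u) (a := 0) (b := (-1 : ℤ))
  rw [zero_add] at hcoeff
  rw [hf, add_mul, one_mul, HahnSeries.coeff_add, hneg, zero_add, hcoeff, hzero] at hsnd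
  have hfst : (PowerSeries.constantCoeff u).fst = 0 := by simpa using hsnd
  have hunit : IsUnit (PowerSeries.constantCoeff u) := (g⁻¹).isUnit.map _
  exact (TrivSqZeroExt.isUnit_iff_isUnit_fst.mp hunit).ne_zero hfst
end

section
/- Let A be a commutative ring and σ : A → A a ring homomorphism with σ∘σ = id; write x̄ = σ(x). Let c, d ∈ A with d a unit (then d̄ is also a unit) and c·c̄ = d + d̄. Then the following identity of 3×3 matrices over A holds (Steinberg's identity for the quasi-split special unitary group SU₃): diag(−d, d̄·d^{-1}, −d̄^{-1}) = x(c,d) · y(−c̄·d̄^{-1}, d̄^{-1}) · x(c·d̄·d^{-1}, d) · w, where for a, b ∈ A one sets x(a,b) = [[1, −a, −b], [0, 1, ā], [0, 0, 1]], y(a,b) = [[1, 0, 0], [−a, 1, 0], [−b, ā, 1]], and w = [[0, 0, 1], [0, −1, 0], [1, 0, 0]]. -/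
section SU3

variable {A : Type*} [CommRing A]

/-- The upper unipotent element `x(a,b)` of the quasi-split `SU₃`. -/
def SU3x (σ : A →+* A) (a b : A) : Matrix (Fin 3) (Fin 3) A :=
  !![1, -a, -b; 0, 1, σ a; 0, 0, 1]

/-- The lower unipotent element `y(a,b)` of the quasi-split `SU₃`. -/
def SU3y (σ : A →+* A) (a b : A) : Matrix (Fin 3) (Fin 3) A :=
  !![1, 0, 0; -a, 1, 0; -b, σ a, 1]

/-- The Weyl element `w` of the quasi-split `SU₃`. -/
def SU3w : Matrix (Fin 3) (Fin 3) A :=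
  !![0, 0, 1; 0, -1, 0; 1, 0, 0]

/-- Steinberg's identity for the quasi-split `SU₃`.
Let `A` be a commutative ring with an involution `σ` (written `x̄ = σ x`), let
`d` be a unit with inverse `dinv`, and let `c` satisfy `c·c̄ = d + d̄`.  Then
`diag(−d, d̄·d⁻¹, −d̄⁻¹) = x(c,d) · y(−c̄·d̄⁻¹, d̄⁻¹) · x(c·d̄·d⁻¹, d) · w`. -/
theorem stmt13 (σ : A →+* A) (hσ : ∀ x : A, σ (σ x) = x)
    (c d dinv : A) (hd : d * dinv = 1) (hcd : c * σ c = d + σ d) :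
    !![-d, 0, 0; 0, σ d * dinv, 0; 0, 0, -(σ dinv)] =
      SU3x σ c d *
        SU3y σ (-(σ c * σ dinv)) (σ dinv) *
        SU3x σ (c * σ d * dinv) d *
        SU3w := by
  have hσd : σ d * σ dinv = 1 := by rw [← map_mul, hd, map_one]
  ext i j
  fin_cases i <;> fin_cases j <;>
    simp [SU3x, SU3y, SU3w, Matrix.mul_apply, Fin.sum_univ_three, hσ] <;> grind

end SU3
end

section
/- Let R be a commutative Artinian local ring with maximal ideal m and residue field κ = R/m. Then R((t)) is a local ring whose maximal ideal is the nilpotent ideal m·R((t)), consisting exactly of the Laurent series all of whose coefficients lie in m; the coefficientwise reduction map R((t)) → κ((t)) is surjective with kernel m·R((t)), so the residue field of R((t)) is isomorphic to κ((t)); and R((t)) is a henselian local ring. -/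
namespace HahnSeries

variable {Γ R S : Type*}

section Map

variable [AddCommMonoid Γ] [PartialOrder Γ] [IsOrderedCancelAddMonoid Γ]

/-- The coefficientwise map of Hahn series, as a ring homomorphism. -/
def mapRingHom (Γ : Type*) [AddCommMonoid Γ] [PartialOrder Γ] [IsOrderedCancelAddMonoid Γ]
    [Semiring R] [Semiring S] (f : R →+* S) : HahnSeries Γ R →+* HahnSeries Γ S where
  toFun x := x.map f
  map_zero' := by ext; simp
  map_one' := HahnSeries.map_one f.toMonoidWithZeroHom
  map_add' _ _ := by ext; simp
  map_mul' _ _ := HahnSeries.map_mul (f : R →ₙ+* S)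

@[simp]
theorem mapRingHom_apply [Semiring R] [Semiring S] (f : R →+* S) (x : HahnSeries Γ R) :
    mapRingHom Γ f x = x.map f :=
  rfl

theorem mapRingHom_surjective [Semiring R] [Semiring S] {f : R →+* S}
    (hf : Function.Surjective f) : Function.Surjective (mapRingHom Γ f) := by
  classical
  intro y
  refine ⟨⟨fun n => if y.coeff n = 0 then 0 else Function.surjInv hf (y.coeff n),
    y.isPWO_support.mono fun n hn => ?_⟩, ?_⟩
  · intro h
    simp [h] at hn
  · ext n
    by_cases h : y.coeff n = 0
    · simp [h]
    · simp [h, Function.surjInv_eq hf]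

theorem mem_ker_mapRingHom [Semiring R] [Semiring S] {f : R →+* S} {x : HahnSeries Γ R} :
    x ∈ RingHom.ker (mapRingHom Γ f) ↔ ∀ n, x.coeff n ∈ RingHom.ker f := by
  simp [RingHom.mem_ker, HahnSeries.ext_iff, funext_iff]

/-- For a finitely generated ideal `I`, every Hahn series with coefficients in `I` lies in the
extension of `I`. -/
theorem mem_map_C_of_coeff_mem [CommRing R] {I : Ideal R} (hI : I.FG) {x : HahnSeries Γ R}
    (hx : ∀ n, x.coeff n ∈ I) : x ∈ I.map (C : R →+* HahnSeries Γ R) := by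
  classical
  obtain ⟨k, v, rfl⟩ := Submodule.fg_iff_exists_fin_generating_family.mp hI
  choose c hc using fun n => (Submodule.mem_span_range_iff_exists_fun R).mp (hx n)
  let y (i : Fin k) : HahnSeries Γ R :=
    ⟨fun n => if x.coeff n = 0 then 0 else c n i, x.isPWO_support.mono fun n hn h => by
      simp [h] at hn⟩
  have hxy : x = ∑ i, C (v i) * y i := by
    ext n
    by_cases h : x.coeff n = 0
    · simp [y, h]
    · simp [y, ← hc n, mul_comm]
  rw [hxy]
  exact Ideal.sum_mem _ fun i _ => Ideal.mul_mem_right _ _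
    (Ideal.mem_map_of_mem _ (Submodule.subset_span ⟨i, rfl⟩))

theorem ker_mapRingHom [CommRing R] [Semiring S] {f : R →+* S} (hf : (RingHom.ker f).FG) :
    RingHom.ker (mapRingHom Γ f) = (RingHom.ker f).map C := by
  refine le_antisymm (fun x hx => mem_map_C_of_coeff_mem hf (mem_ker_mapRingHom.mp hx)) ?_
  rw [Ideal.map_le_iff_le_comap]
  intro r hr
  rw [RingHom.mem_ker] at hr
  ext n
  by_cases h : n = 0 <;> simp [C_apply, h, hr]

end Map

end HahnSeries

theorem IsLocalRing.of_isMaximal_of_isNilpotent {A : Type*} [CommRing A] {I : Ideal A}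
    (hI : I.IsMaximal) (hn : IsNilpotent I) : IsLocalRing A := by
  refine .of_unique_max_ideal ⟨I, hI, fun J hJ => ?_⟩
  obtain ⟨n, hn⟩ := hn
  exact (hI.eq_of_le hJ.ne_top (hJ.isPrime.le_of_pow_le (n := n) (by simp [hn]))).symm

theorem IsAdicComplete.of_isNilpotent {A : Type*} [CommRing A] {I : Ideal A}
    (hI : IsNilpotent I) : IsAdicComplete I A := by
  obtain ⟨k, hk⟩ := hI
  refine { haus' := fun x hx => ?_, prec' := fun f hf => ⟨f k, fun n => ?_⟩ }
  · simpa [hk, SModEq.zero] using hx k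
  · rcases le_total n k with h | h
    · exact hf h
    · have hfk : f k = f n := by simpa [hk, SModEq.bot] using hf h
      rw [hfk]

theorem HenselianLocalRing.of_isNilpotent_maximalIdeal {A : Type*} [CommRing A] [IsLocalRing A]
    (h : IsNilpotent (IsLocalRing.maximalIdeal A)) : HenselianLocalRing A where
  is_henselian f hf a ha hu :=
    have := IsAdicComplete.of_isNilpotent h
    HenselianRing.is_henselian f hf a ha (hu.map _)


/-- Let `R` be a commutative Artinian local ring with maximal
ideal `m` and residue field `κ`.  Then `R((t))` is a local ring whose maximal
ideal is the nilpotent ideal `m·R((t))`, which consists exactly of the Laurent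
series all of whose coefficients lie in `m`; the coefficientwise reduction map
`R((t)) → κ((t))` is surjective with kernel `m·R((t))`, so the residue field
of `R((t))` is isomorphic to `κ((t))`; and `R((t))` is a henselian local
ring. -/
theorem stmt16 (R : Type*) [CommRing R] [IsArtinianRing R] [IsLocalRing R] :
    IsLocalRing (LaurentSeries R) ∧
    (Ideal.map (HahnSeries.C : R →+* LaurentSeries R)
        (IsLocalRing.maximalIdeal R)).IsMaximal ∧
    IsNilpotent (Ideal.map (HahnSeries.C : R →+* LaurentSeries R)
        (IsLocalRing.maximalIdeal R)) ∧
    (∀ f : LaurentSeries R,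
      f ∈ Ideal.map (HahnSeries.C : R →+* LaurentSeries R)
            (IsLocalRing.maximalIdeal R) ↔
        ∀ n : ℤ, f.coeff n ∈ IsLocalRing.maximalIdeal R) ∧
    Function.Surjective
      (fun f : LaurentSeries R => f.map (IsLocalRing.residue R)) ∧
    (∀ f : LaurentSeries R,
      f.map (IsLocalRing.residue R) = 0 ↔
        f ∈ Ideal.map (HahnSeries.C : R →+* LaurentSeries R)
              (IsLocalRing.maximalIdeal R)) ∧
    Nonempty
      ((LaurentSeries R ⧸ Ideal.map (HahnSeries.C : R →+* LaurentSeries R)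
          (IsLocalRing.maximalIdeal R)) ≃+*
        LaurentSeries (IsLocalRing.ResidueField R)) ∧
    HenselianLocalRing (LaurentSeries R) := by
  have hker : RingHom.ker (IsLocalRing.residue R) = IsLocalRing.maximalIdeal R :=
    IsLocalRing.ker_residue
  have hkermap := HahnSeries.ker_mapRingHom (Γ := ℤ)
    ((isNoetherianRing_iff_ideal_fg R).mp inferInstance (RingHom.ker (IsLocalRing.residue R)))
  have hsurj := HahnSeries.mapRingHom_surjective (Γ := ℤ) (IsLocalRing.residue_surjective (R := R))
  have hmem (f : LaurentSeries R) := HahnSeries.mem_ker_mapRingHom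
    (f := IsLocalRing.residue R) (x := f)
  rw [hker] at hkermap hmem
  have hmax := RingHom.ker_isMaximal_of_surjective
    (K := LaurentSeries (IsLocalRing.ResidueField R)) _ hsurj
  have hnil : IsNilpotent (Ideal.map (HahnSeries.C : R →+* LaurentSeries R)
      (IsLocalRing.maximalIdeal R)) := by
    obtain ⟨n, hn⟩ := IsArtinianRing.isNilpotent_jacobson_bot (R := R)
    rw [IsLocalRing.jacobson_eq_maximalIdeal ⊥ bot_ne_top] at hn
    exact ⟨n, by rw [← Ideal.map_pow, hn, Ideal.zero_eq_bot, Ideal.map_bot]; rfl⟩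
  rw [← hkermap] at hnil ⊢
  have hlocal := IsLocalRing.of_isMaximal_of_isNilpotent hmax hnil
  refine ⟨hlocal, hmax, hnil, hmem, hsurj, fun f => Iff.rfl,
    ⟨RingHom.quotientKerEquivOfSurjective hsurj⟩, ?_⟩
  rw [IsLocalRing.eq_maximalIdeal hmax] at hnil
  exact .of_isNilpotent_maximalIdeal hnil
end
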